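/- Let A be a Hilbert-Schmidt operator on a separable Hilbert space H, and for λ > 1 let D_λ be the diagonal operator e_i ↦ λ^{−i} e_i. Then Ξ_k(D_3 A D_3) − Ξ_k(A) ≥ (log 3 / log 2)² (Ξ_k(D_2 A D_2) − Ξ_k(A)), where Ξ_k(B) = Σ_{j=1}^k log s_j(B). -/

import Mathlib

/-- The `j`-th singular value of a map between normed spaces, via the
Courant–Fischer max-min characterization. -/
noncomputable def singVal {E F : Type*} [NormedAddCommGroup E] [NormedSpace ℝ E]
    [NormedAddCommGroup F] (A : E → F) (j : ℕ) : ℝ :=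
  ⨆ V : {V : Submodule ℝ E // Module.finrank ℝ V = j},
    ⨅ x : {x : E // x ∈ V.1 ∧ ‖x‖ = 1}, ‖A x‖

/-- `Ξ_k(A) = log (s₁(A) ⋯ s_k(A))`. -/
noncomputable def Xi {E F : Type*} [NormedAddCommGroup E] [NormedSpace ℝ E]
    [NormedAddCommGroup F] (k : ℕ) (A : E → F) : ℝ :=
  ∑ j ∈ Finset.range k, Real.log (singVal A (j + 1))

section aux
variable {E F : Type*} [NormedAddCommGroup E] [InnerProductSpace ℝ E]
  [NormedAddCommGroup F] [InnerProductSpace ℝ F]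

lemma singVal_nonneg {E F : Type*} [NormedAddCommGroup E] [NormedSpace ℝ E]
    [NormedAddCommGroup F] (A : E → F) (j : ℕ) : 0 ≤ singVal A j :=
  Real.iSup_nonneg fun _ => Real.iInf_nonneg fun _ => norm_nonneg _

lemma exists_unit {j : ℕ} {V : Submodule ℝ E} (hV : Module.finrank ℝ V = j + 1) :
    ∃ x ∈ V, ‖x‖ = 1 := by
  have : Nontrivial V := Module.nontrivial_of_finrank_pos (R := ℝ) (by omega)
  obtain ⟨x, hx⟩ := exists_ne (0 : V)
  have hx' : ‖(x : E)‖ ≠ 0 := by simpa using hx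
  refine ⟨‖(x : E)‖⁻¹ • (x : E), V.smul_mem _ x.2, ?_⟩
  rw [norm_smul, norm_inv, norm_norm, inv_mul_cancel₀ hx']

lemma le_singVal (B : E →ₗ[ℝ] F) (K : ℝ) (hK : ∀ x, ‖B x‖ ≤ K * ‖x‖) {j : ℕ}
    (V : Submodule ℝ E) (hV : Module.finrank ℝ V = j + 1) (c : ℝ)
    (h : ∀ x ∈ V, c * ‖x‖ ≤ ‖B x‖) : c ≤ singVal B (j + 1) := by
  have hb : BddAbove (Set.range fun V : {V : Submodule ℝ E // Module.finrank ℝ V = j + 1} =>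
      ⨅ x : {x : E // x ∈ V.1 ∧ ‖x‖ = 1}, ‖B x‖) := by
    refine ⟨K, ?_⟩
    rintro _ ⟨W, rfl⟩
    obtain ⟨x, hx, hx1⟩ := exists_unit W.2
    have := ciInf_le (f := fun x : {x : E // x ∈ W.1 ∧ ‖x‖ = 1} => ‖B x‖)
      ⟨0, by rintro _ ⟨y, rfl⟩; exact norm_nonneg _⟩ ⟨x, hx, hx1⟩
    refine this.trans ?_
    simpa [hx1] using hK x
  refine le_trans ?_ (le_ciSup hb ⟨V, hV⟩)
  obtain ⟨x, hx, hx1⟩ := exists_unit hV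
  have : Nonempty {x : E // x ∈ V ∧ ‖x‖ = 1} := ⟨⟨x, hx, hx1⟩⟩
  refine le_ciInf fun y => ?_
  simpa [y.2.2] using h y y.2.1

lemma exists_of_lt_singVal (B : E →ₗ[ℝ] F) {j : ℕ} (c : ℝ) (hc : 0 ≤ c)
    (h : c < singVal B j) : ∃ V : Submodule ℝ E, Module.finrank ℝ V = j ∧
      ∀ x ∈ V, c * ‖x‖ ≤ ‖B x‖ := by
  have hne : Nonempty {V : Submodule ℝ E // Module.finrank ℝ V = j} := by
    by_contra hn
    rw [not_nonempty_iff] at hn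
    rw [singVal, Real.iSup_of_isEmpty] at h
    linarith
  obtain ⟨V, hV⟩ := exists_lt_of_lt_ciSup h
  refine ⟨V.1, V.2, fun x hx => ?_⟩
  by_cases hx0 : x = 0
  · simp [hx0]
  have hx' : ‖x‖ ≠ 0 := by simpa using hx0
  have := ciInf_le (f := fun x : {x : E // x ∈ V.1 ∧ ‖x‖ = 1} => ‖B x‖)
      ⟨0, by rintro _ ⟨y, rfl⟩; exact norm_nonneg _⟩ ⟨‖x‖⁻¹ • x, V.1.smul_mem _ hx, by
        rw [norm_smul, norm_inv, norm_norm, inv_mul_cancel₀ hx']⟩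
  have h2 := hV.le.trans this
  simp only [map_smul, norm_smul, norm_inv, norm_norm] at h2
  rwa [le_inv_mul_iff₀ (by positivity), mul_comm] at h2

/-- general comparison -/
lemma singVal_le_singVal {E' F' : Type*} [NormedAddCommGroup E'] [InnerProductSpace ℝ E']
    [NormedAddCommGroup F'] [InnerProductSpace ℝ F']
    (B : E →ₗ[ℝ] F) (K : ℝ) (hK : ∀ x, ‖B x‖ ≤ K * ‖x‖) (B' : E' →ₗ[ℝ] F')
    (J : E' →ₗ[ℝ] E) (hJ : Function.Injective J) (hJ1 : ∀ x, ‖J x‖ ≤ ‖x‖)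
    (h : ∀ x, ‖B' x‖ ≤ ‖B (J x)‖) (j : ℕ) : singVal B' (j + 1) ≤ singVal B (j + 1) := by
  refine le_of_forall_lt_imp_le_of_dense fun c hc => ?_
  rcases lt_or_ge c 0 with h0 | h0
  · exact h0.le.trans (singVal_nonneg _ _)
  obtain ⟨V, hV, hVc⟩ := exists_of_lt_singVal B' c h0 hc
  refine le_singVal B K hK (V.map J) ?_ c ?_
  · rw [(Submodule.equivMapOfInjective J hJ V).symm.finrank_eq, hV]
  · rintro _ ⟨x, hx, rfl⟩
    calc c * ‖J x‖ ≤ c * ‖x‖ := by gcongr; exact hJ1 x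
      _ ≤ ‖B' x‖ := hVc x hx
      _ ≤ _ := h x

lemma norm_sq_eq_sum' {n : ℕ} (b : OrthonormalBasis (Fin n) ℝ E) (x : E) :
    ‖x‖ ^ 2 = ∑ a, (inner ℝ (b a) x) ^ 2 := by
  rw [← real_inner_self_eq_norm_sq, ← OrthonormalBasis.sum_inner_mul_inner b]
  refine Finset.sum_congr rfl fun a _ => ?_
  rw [real_inner_comm]; ring

variable [FiniteDimensional ℝ E] [FiniteDimensional ℝ F]

lemma norm_sq_eq_sum (M : E →ₗ[ℝ] F) {n : ℕ} (hn : Module.finrank ℝ E = n) (x : E) :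
    ‖M x‖ ^ 2 = ∑ a, M.isSymmetric_adjoint_comp_self.eigenvalues hn a *
      (inner ℝ (M.isSymmetric_adjoint_comp_self.eigenvectorBasis hn a) x) ^ 2 := by
  set hT := M.isSymmetric_adjoint_comp_self
  rw [← real_inner_self_eq_norm_sq, ← LinearMap.adjoint_inner_right]
  rw [← OrthonormalBasis.sum_inner_mul_inner (hT.eigenvectorBasis hn)]
  refine Finset.sum_congr rfl fun a _ => ?_
  have := hT.eigenvectorBasis_apply_self_apply hn x a
  rw [OrthonormalBasis.repr_apply_apply, OrthonormalBasis.repr_apply_apply] at this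
  simp only [LinearMap.comp_apply] at this
  rw [this, real_inner_comm]
  simp only [RCLike.ofReal_real_eq_id, id]
  ring

lemma singVal_sq_le_eigenvalues (M : E →ₗ[ℝ] F) {n : ℕ} (hn : Module.finrank ℝ E = n)
    (j : Fin n) : singVal M (j + 1) ^ 2 ≤
      M.isSymmetric_adjoint_comp_self.eigenvalues hn j := by
  set hT := M.isSymmetric_adjoint_comp_self
  have hl := M.isPositive_adjoint_comp_self.nonneg_eigenvalues hn j
  refine Real.le_sqrt (singVal_nonneg _ _) hl |>.1 ?_
  refine le_of_forall_lt_imp_le_of_dense fun c hc => ?_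
  rcases lt_or_ge c 0 with h0 | h0
  · exact h0.le.trans (Real.sqrt_nonneg _)
  obtain ⟨V, hV, hVc⟩ := exists_of_lt_singVal M c h0 hc
  refine Real.le_sqrt h0 hl |>.2 ?_
  let f : V →ₗ[ℝ] (Fin j → ℝ) := LinearMap.pi fun a =>
    (innerₛₗ ℝ (hT.eigenvectorBasis hn (Fin.castLE j.2.le a))).comp V.subtype
  have hker : LinearMap.ker f ≠ ⊥ := LinearMap.ker_ne_bot_of_finrank_lt (by simp [hV])
  obtain ⟨x, hx, hx0⟩ := Submodule.exists_mem_ne_zero_of_ne_bot hker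
  have hxa : ∀ a : Fin n, a < j → inner ℝ (hT.eigenvectorBasis hn a) (x : E) = 0 := by
    intro a ha
    have := congrFun (LinearMap.mem_ker.1 hx) ⟨a, ha⟩
    simpa [f] using this
  have h1 := hVc x x.2
  have h2 : (c * ‖(x : E)‖) ^ 2 ≤ ‖M x‖ ^ 2 := by gcongr
  rw [mul_pow, norm_sq_eq_sum M hn, norm_sq_eq_sum' (hT.eigenvectorBasis hn)] at h2
  have h3 : ∑ a, hT.eigenvalues hn a * (inner ℝ (hT.eigenvectorBasis hn a) (x : E)) ^ 2 ≤
      hT.eigenvalues hn j * ∑ a, (inner ℝ (hT.eigenvectorBasis hn a) (x : E)) ^ 2 := by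
    rw [Finset.mul_sum]
    refine Finset.sum_le_sum fun a _ => ?_
    rcases lt_or_ge a j with h | h
    · simp [hxa a h]
    · have := hT.eigenvalues_antitone hn h
      gcongr
  refine le_of_mul_le_mul_right (h2.trans h3) ?_
  rw [← norm_sq_eq_sum']
  have : ‖(x : E)‖ ≠ 0 := by simpa using hx0
  positivity

lemma eigenvalues_le_singVal_sq (C : F →ₗ[ℝ] F) {n : ℕ} (hn : Module.finrank ℝ F = n)
    {E G : Type*} [NormedAddCommGroup E] [InnerProductSpace ℝ E]
    [NormedAddCommGroup G] [InnerProductSpace ℝ G]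
    (B : E →ₗ[ℝ] G) (K : ℝ) (hK : ∀ x, ‖B x‖ ≤ K * ‖x‖) (U : F →ₗᵢ[ℝ] E)
    (h : ∀ x, ‖C x‖ ≤ ‖B (U x)‖)
    (j : Fin n) : C.isSymmetric_adjoint_comp_self.eigenvalues hn j ≤ singVal B (j + 1) ^ 2 := by
  set hT := C.isSymmetric_adjoint_comp_self
  have hl := C.isPositive_adjoint_comp_self.nonneg_eigenvalues hn
  refine Real.sqrt_le_left (singVal_nonneg _ _) |>.1 ?_
  refine le_trans ?_ (singVal_le_singVal B K hK C U.toLinearMap U.injective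
    (fun x => (U.norm_map x).le) h j)
  let u : Fin (j + 1) → F := fun a => hT.eigenvectorBasis hn (Fin.castLE j.2 a)
  have hu : LinearIndependent ℝ u :=
    (hT.eigenvectorBasis hn).orthonormal.linearIndependent.comp _ (Fin.castLE_injective _)
  refine le_singVal C ‖C.toContinuousLinearMap‖ C.toContinuousLinearMap.le_opNorm
    (Submodule.span ℝ (Set.range u)) ?_ _ ?_
  · rw [finrank_span_eq_card hu]; simp
  intro x hx
  have hxa : ∀ a : Fin n, j < a → inner ℝ (hT.eigenvectorBasis hn a) x = 0 := by
    intro a ha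
    have : Submodule.span ℝ (Set.range u) ≤
        LinearMap.ker (innerₛₗ ℝ (hT.eigenvectorBasis hn a)) := by
      rw [Submodule.span_le]
      rintro _ ⟨b, rfl⟩
      have hb : a ≠ Fin.castLE j.2 b := by
        intro hab
        have := b.2
        have h3 : (a : ℕ) = b := by rw [hab]; rfl
        have h4 : (j : ℕ) < a := ha
        omega
      simpa [u] using (hT.eigenvectorBasis hn).orthonormal.2 hb
    simpa using this hx
  refine le_of_sq_le_sq ?_ (norm_nonneg _)
  rw [mul_pow, Real.sq_sqrt (hl j), norm_sq_eq_sum C hn, norm_sq_eq_sum' (hT.eigenvectorBasis hn),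
    Finset.mul_sum]
  refine Finset.sum_le_sum fun a _ => ?_
  rcases lt_or_ge j a with h | h
  · simp [hxa a h]
  · have := hT.eigenvalues_antitone hn h
    gcongr

lemma det_adjoint_real (C : F →ₗ[ℝ] F) :
    LinearMap.det (LinearMap.adjoint C) = LinearMap.det C := by
  let b := stdOrthonormalBasis ℝ F
  rw [← LinearMap.det_toMatrix b.toBasis, ← LinearMap.det_toMatrix b.toBasis,
    LinearMap.toMatrix_adjoint, Matrix.det_conjTranspose, star_trivial]

lemma abs_det_le (C : F →ₗ[ℝ] F) {n : ℕ} (hn : Module.finrank ℝ F = n)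
    {E G : Type*} [NormedAddCommGroup E] [InnerProductSpace ℝ E]
    [NormedAddCommGroup G] [InnerProductSpace ℝ G]
    (B : E →ₗ[ℝ] G) (K : ℝ) (hK : ∀ x, ‖B x‖ ≤ K * ‖x‖) (U : F →ₗᵢ[ℝ] E)
    (h : ∀ x, ‖C x‖ ≤ ‖B (U x)‖) :
    |LinearMap.det C| ≤ ∏ j ∈ Finset.range n, singVal B (j + 1) := by
  have h1 := C.isSymmetric_adjoint_comp_self.det_eq_prod_eigenvalues hn
  rw [LinearMap.det_comp, det_adjoint_real] at h1
  simp only [RCLike.ofReal_real_eq_id, id] at h1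
  refine abs_le_of_sq_le_sq ?_ (Finset.prod_nonneg fun _ _ => singVal_nonneg _ _)
  rw [pow_two, h1, ← Finset.prod_pow, Finset.prod_range]
  exact Finset.prod_le_prod
    (fun j _ => C.isPositive_adjoint_comp_self.nonneg_eigenvalues hn j)
    (fun j _ => eigenvalues_le_singVal_sq C hn B K hK U h j)

lemma exists_isometry {k : ℕ} (w : Fin k → E) (hw : LinearIndependent ℝ w) :
    ∃ U : EuclideanSpace ℝ (Fin k) →ₗᵢ[ℝ] E, ∀ i, ∃ y, U y = w i := by
  let W := Submodule.span ℝ (Set.range w)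
  have hW : Module.finrank ℝ W = k := by rw [finrank_span_eq_card hw]; simp
  let b := (stdOrthonormalBasis ℝ W).reindex (finCongr hW)
  refine ⟨W.subtypeₗᵢ.comp b.repr.symm.toLinearIsometry, fun i => ?_⟩
  refine ⟨b.repr ⟨w i, Submodule.subset_span ⟨i, rfl⟩⟩, ?_⟩
  simp

lemma isometry_adjoint (U : F →ₗᵢ[ℝ] E) (y : F) :
    LinearMap.adjoint U.toLinearMap (U y) = y := by
  refine ext_inner_left ℝ fun v => ?_
  rw [LinearMap.adjoint_inner_right]
  simp

lemma isometry_adjoint_norm_le (U : F →ₗᵢ[ℝ] E) (y : E) :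
    ‖LinearMap.adjoint U.toLinearMap y‖ ≤ ‖y‖ := by
  set z := LinearMap.adjoint U.toLinearMap y with hz
  have h1 : ‖z‖ ^ 2 = inner ℝ (U z) y := by
    rw [← real_inner_self_eq_norm_sq]
    conv_lhs => rw [hz, LinearMap.adjoint_inner_right]
    rfl
  have h2 := real_inner_le_norm (U z) y
  rw [U.norm_map] at h2
  by_cases h0 : ‖z‖ = 0
  · rw [h0]; exact norm_nonneg _
  · have : 0 < ‖z‖ := lt_of_le_of_ne (norm_nonneg _) (Ne.symm h0)
    nlinarith

lemma det_of_eigenbasis {k : ℕ} (T : EuclideanSpace ℝ (Fin k) →ₗ[ℝ] EuclideanSpace ℝ (Fin k))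
    (y : Fin k → EuclideanSpace ℝ (Fin k)) (hyLI : LinearIndependent ℝ y) (lam : Fin k → ℝ)
    (h : ∀ i, T (y i) = lam i • y i) : LinearMap.det T = ∏ i, lam i := by
  obtain ⟨b, hb⟩ : ∃ b : Module.Basis (Fin k) ℝ (EuclideanSpace ℝ (Fin k)), ∀ i, b i = y i :=
    ⟨basisOfLinearIndependentOfCardEqFinrank' y hyLI (by simp), fun i => by simp⟩
  rw [← LinearMap.det_toMatrix b]
  have : LinearMap.toMatrix b b T = Matrix.diagonal lam := by
    ext i j
    rw [LinearMap.toMatrix_apply]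
    rw [hb, h, ← hb, map_smul, Module.Basis.repr_self]
    by_cases hij : i = j
    · subst hij; simp
    · simp [Matrix.diagonal_apply_ne _ hij, Ne.symm hij]
  rw [this, Matrix.det_diagonal]

lemma prod_le_of_eigen (A B : E →ₗ[ℝ] E) {k : ℕ} (w : Fin k → E) (hw : LinearIndependent ℝ w)
    (lam : Fin k → ℝ) (hz : ∀ i, lam i ≠ 0)
    (hTw : ∀ i, LinearMap.adjoint B (A (w i)) = lam i • w i) :
    ∏ i, lam i ≤ (∏ j ∈ Finset.range k, singVal A (j + 1)) *
      ∏ j ∈ Finset.range k, singVal B (j + 1) := by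
  have hAw : LinearIndependent ℝ (fun i => A (w i)) := by
    have : LinearIndependent ℝ (fun i => LinearMap.adjoint B (A (w i))) := by
      simp only [hTw]
      exact hw.units_smul (fun i => Units.mk0 _ (hz i))
    exact LinearIndependent.of_comp (LinearMap.adjoint B) this
  obtain ⟨U, hU⟩ := exists_isometry w hw
  obtain ⟨U', hU'⟩ := exists_isometry _ hAw
  choose y hy using hU
  choose y' hy' using hU'
  have hyLI : LinearIndependent ℝ y := by
    refine LinearIndependent.of_comp U.toLinearMap ?_
    have : U.toLinearMap ∘ y = w := funext hy
    rw [this]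
    exact hw
  obtain ⟨X, hX⟩ : ∃ X, X = LinearMap.adjoint U'.toLinearMap ∘ₗ B ∘ₗ U.toLinearMap := ⟨_, rfl⟩
  obtain ⟨Y, hY⟩ : ∃ Y, Y = LinearMap.adjoint U'.toLinearMap ∘ₗ A ∘ₗ U.toLinearMap := ⟨_, rfl⟩
  have hXY : ∀ i, (LinearMap.adjoint X ∘ₗ Y) (y i) = lam i • y i := by
    intro i
    have e1 : Y (y i) = y' i := by
      simp only [hY, LinearMap.comp_apply, LinearIsometry.coe_toLinearMap]
      rw [hy, ← hy', isometry_adjoint]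
    rw [LinearMap.comp_apply, e1]
    simp only [hX, LinearMap.adjoint_comp, LinearMap.adjoint_adjoint, LinearMap.comp_apply,
      LinearIsometry.coe_toLinearMap]
    rw [hy', hTw, map_smul, ← hy, isometry_adjoint]
  have hdet := det_of_eigenbasis _ y hyLI lam hXY
  rw [← hdet, LinearMap.det_comp, det_adjoint_real]
  have hfr : Module.finrank ℝ (EuclideanSpace ℝ (Fin k)) = k := by simp
  have hX0 : ∀ x, ‖X x‖ ≤ ‖B (U x)‖ := fun x => by
    have := isometry_adjoint_norm_le U' (B (U x))
    rw [hX]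
    simpa only [LinearMap.comp_apply, LinearIsometry.coe_toLinearMap] using this
  have hX1 := abs_det_le X hfr B ‖B.toContinuousLinearMap‖
    (fun x => B.toContinuousLinearMap.le_opNorm x) U hX0
  have hY0 : ∀ x, ‖Y x‖ ≤ ‖A (U x)‖ := fun x => by
    have := isometry_adjoint_norm_le U' (A (U x))
    rw [hY]
    simpa only [LinearMap.comp_apply, LinearIsometry.coe_toLinearMap] using this
  have hY1 := abs_det_le Y hfr A ‖A.toContinuousLinearMap‖
    (fun x => A.toContinuousLinearMap.le_opNorm x) U hY0
  calc _ ≤ |LinearMap.det X| * |LinearMap.det Y| := by rw [← abs_mul]; exact le_abs_self _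
    _ = |LinearMap.det Y| * |LinearMap.det X| := mul_comm _ _
    _ ≤ _ := mul_le_mul hY1 hX1 (abs_nonneg _) (Finset.prod_nonneg fun _ _ => singVal_nonneg _ _)

lemma exists_eigen (M : E →ₗ[ℝ] E) (k : ℕ) (hk : k ≤ Module.finrank ℝ E) :
    ∃ (lam : Fin k → ℝ) (u : Fin k → E), LinearIndependent ℝ u ∧
      (∏ j ∈ Finset.range k, singVal M (j + 1) ^ 2 ≤ ∏ i, lam i) ∧
      ∀ i, LinearMap.adjoint M (M (u i)) = lam i • u i := by
  refine ⟨fun i => M.isSymmetric_adjoint_comp_self.eigenvalues rfl (Fin.castLE hk i),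
    fun i => M.isSymmetric_adjoint_comp_self.eigenvectorBasis rfl (Fin.castLE hk i), ?_, ?_, ?_⟩
  · exact (M.isSymmetric_adjoint_comp_self.eigenvectorBasis
      rfl).orthonormal.linearIndependent.comp _ (Fin.castLE_injective _)
  · rw [Finset.prod_range]
    exact Finset.prod_le_prod (fun _ _ => sq_nonneg _)
      fun i _ => singVal_sq_le_eigenvalues M rfl (Fin.castLE hk i)
  · intro i
    exact M.isSymmetric_adjoint_comp_self.apply_eigenvectorBasis rfl (Fin.castLE hk i)

/-- The finite-dimensional key inequality. -/
lemma key_finite (A D : E →ₗ[ℝ] E) (hD : D.IsSymmetric) (hDi : Function.Injective D) (k : ℕ)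
    (hk : k ≤ Module.finrank ℝ E) :
    ∏ j ∈ Finset.range k, singVal (D ∘ₗ A ∘ₗ D) (j + 1) ^ 2 ≤
      (∏ j ∈ Finset.range k, singVal A (j + 1)) *
      ∏ j ∈ Finset.range k, singVal (D ∘ₗ (D ∘ₗ A ∘ₗ D) ∘ₗ D) (j + 1) := by
  obtain ⟨lam, u, hu, h1, h2⟩ := exists_eigen (D ∘ₗ A ∘ₗ D) k hk
  refine h1.trans ?_
  by_cases hz : ∃ i, lam i = 0
  · obtain ⟨i, hi⟩ := hz
    rw [Finset.prod_eq_zero (Finset.mem_univ i) hi]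
    exact mul_nonneg (Finset.prod_nonneg fun _ _ => singVal_nonneg _ _)
      (Finset.prod_nonneg fun _ _ => singVal_nonneg _ _)
  push Not at hz
  have hw : LinearIndependent ℝ (fun i => D (u i)) := hu.map' D (LinearMap.ker_eq_bot.2 hDi)
  have hDadj : LinearMap.adjoint D = D := (LinearMap.isSymmetric_iff_isSelfAdjoint D).1 hD
  refine prod_le_of_eigen A _ _ hw lam hz fun i => ?_
  rw [← map_smul, ← h2]
  simp only [LinearMap.adjoint_comp, hDadj, LinearMap.comp_apply]

end aux

section trunc
variable {H : Type*} [NormedAddCommGroup H] [InnerProductSpace ℝ H]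

/-- Compression of an operator to a finite-dimensional subspace. -/
noncomputable def comprTo (W : Submodule ℝ H) [FiniteDimensional ℝ W] (A : H →L[ℝ] H) :
    W →ₗ[ℝ] W :=
  (W.orthogonalProjectionOnto ∘L A ∘L W.subtypeL).toLinearMap

variable (W : Submodule ℝ H) [FiniteDimensional ℝ W]

lemma comprTo_apply (A : H →L[ℝ] H) (x : W) :
    ((comprTo W A x : W) : H) = W.starProjection (A x) := rfl

lemma proj_comm (D : H →L[ℝ] H) (hDs : D.toLinearMap.IsSymmetric) (hW : ∀ x ∈ W, D x ∈ W)
    (y : H) : W.starProjection (D y) = D (W.starProjection y) := by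
  refine Submodule.eq_starProjection_of_mem_of_inner_eq_zero ?_ ?_
  · exact hW _ (Submodule.starProjection_apply_mem _ _)
  · intro w hw
    rw [← map_sub]
    have := hDs (y - W.starProjection y) w
    simp only [ContinuousLinearMap.coe_coe] at this
    rw [this]
    exact Submodule.starProjection_inner_eq_zero _ _ (hW w hw)

lemma comprTo_comp (A D : H →L[ℝ] H) (hDs : D.toLinearMap.IsSymmetric)
    (hW : ∀ x ∈ W, D x ∈ W) :
    comprTo W (D ∘L A ∘L D) = comprTo W D ∘ₗ comprTo W A ∘ₗ comprTo W D := by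
  ext x
  simp only [LinearMap.comp_apply, comprTo_apply, ContinuousLinearMap.comp_apply]
  rw [proj_comm W D hDs hW, proj_comm W D hDs hW, proj_comm W D hDs hW]
  rw [Submodule.starProjection_eq_self_iff.2 x.2,
    Submodule.starProjection_eq_self_iff.2 (Submodule.starProjection_apply_mem W (A (D x)))]

lemma comprTo_symm (D : H →L[ℝ] H) (hDs : D.toLinearMap.IsSymmetric)
    (hW : ∀ x ∈ W, D x ∈ W) : (comprTo W D).IsSymmetric := by
  intro x y
  rw [Submodule.coe_inner, Submodule.coe_inner, comprTo_apply, comprTo_apply,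
    Submodule.starProjection_eq_self_iff.2 (hW x x.2),
    Submodule.starProjection_eq_self_iff.2 (hW y y.2)]
  exact hDs x y

lemma comprTo_inj (D : H →L[ℝ] H) (hDi : Function.Injective D)
    (hW : ∀ x ∈ W, D x ∈ W) : Function.Injective (comprTo W D) := by
  intro x y h
  have := congrArg (Subtype.val) h
  rw [comprTo_apply, comprTo_apply,
    Submodule.starProjection_eq_self_iff.2 (hW x x.2),
    Submodule.starProjection_eq_self_iff.2 (hW y y.2)] at this
  exact Subtype.ext (hDi this)

lemma singVal_comprTo_le (A : H →L[ℝ] H) (j : ℕ) :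
    singVal (comprTo W A) (j + 1) ≤ singVal A (j + 1) :=
  singVal_le_singVal A.toLinearMap ‖A‖ A.le_opNorm (comprTo W A) W.subtype
    W.injective_subtype (fun x => le_rfl)
    (fun x => by
      have h : ‖comprTo W A x‖ = ‖W.starProjection (A x)‖ := rfl
      rw [h]
      exact Submodule.norm_starProjection_apply_le _ _) j

lemma le_singVal_comprTo (M : H →L[ℝ] H) (δ : ℝ)
    (h : ∀ x, ‖M x - W.starProjection (M (W.starProjection x))‖ ≤ δ * ‖x‖) (hδ : 0 ≤ δ) (j : ℕ) :
    singVal M (j + 1) - δ ≤ singVal (comprTo W M) (j + 1) := by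
  refine le_of_forall_lt_imp_le_of_dense fun c hc => ?_
  rcases le_or_gt c 0 with h0 | h0
  · exact h0.trans (singVal_nonneg _ _)
  obtain ⟨V, hV, hVc⟩ := exists_of_lt_singVal M.toLinearMap (c + δ) (by positivity)
    (j := j + 1) (by simpa using by linarith)
  have hV2 : ∀ x ∈ V, c * ‖x‖ ≤ ‖W.starProjection (M (W.starProjection x))‖ := by
    intro x hx
    have h1 := hVc x hx
    simp only [ContinuousLinearMap.coe_coe] at h1
    have h2 := h x
    have h3 := norm_sub_norm_le (M x) (W.starProjection (M (W.starProjection x)))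
    linarith
  let Q : H →ₗ[ℝ] W := W.orthogonalProjectionOnto.toLinearMap
  have hQ : ∀ x, ((Q x : W) : H) = W.starProjection x := fun x => rfl
  have hinj : Function.Injective (Q.domRestrict V) := by
    rw [← LinearMap.ker_eq_bot, LinearMap.ker_eq_bot']
    intro x hx
    have h1 : W.starProjection (x : H) = 0 := by
      rw [← hQ]
      have : Q (x : H) = 0 := hx
      simp [this]
    have h2 := hV2 x x.2
    rw [h1, map_zero, map_zero, norm_zero] at h2
    have h3 : ‖(x : H)‖ ≤ 0 := by nlinarith
    simpa using h3
  refine le_singVal (comprTo W M) _ (comprTo W M).toContinuousLinearMap.le_opNorm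
    (LinearMap.range (Q.domRestrict V)) ?_ c ?_
  · rw [LinearMap.finrank_range_of_inj hinj, hV]
  · rintro _ ⟨x, rfl⟩
    have e1 : ‖comprTo W M (Q.domRestrict V x)‖ =
      ‖W.starProjection (M (W.starProjection (x : H)))‖ := rfl
    have e2 : ‖Q.domRestrict V x‖ = ‖W.starProjection (x : H)‖ := rfl
    rw [e1, e2]
    refine le_trans ?_ (hV2 x x.2)
    gcongr
    exact Submodule.norm_starProjection_apply_le _ _

end trunc

section diag
variable {H : Type*} [NormedAddCommGroup H] [InnerProductSpace ℝ H]
  (e : HilbertBasis ℕ ℝ H)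

lemma diag_inner (D : H →L[ℝ] H) (d : ℕ → ℝ) (hD : ∀ i, D (e i) = d i • e i) (i : ℕ) (x : H) :
    inner ℝ (e i) (D x) = d i * inner ℝ (e i) x := by
  have : (innerSL ℝ (e i)) ∘L D = d i • innerSL ℝ (e i) := by
    refine ContinuousLinearMap.ext_on (s := Set.range e) ?_ ?_
    · rw [Submodule.dense_iff_topologicalClosure_eq_top]; exact e.dense_span
    · rintro _ ⟨j, rfl⟩
      simp only [ContinuousLinearMap.comp_apply, hD, smul_apply,
        innerSL_apply_apply, inner_smul_right, smul_eq_mul]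
      rw [orthonormal_iff_ite.1 e.orthonormal]
      by_cases hij : i = j
      · simp [hij]
      · simp [hij]
  simpa using congrArg (fun f => f x) this

lemma hasSum_sq (x : H) : HasSum (fun i => (inner ℝ (e i) x) ^ 2) (‖x‖ ^ 2) := by
  have := e.hasSum_inner_mul_inner x x
  rw [real_inner_self_eq_norm_sq] at this
  have h : (fun i => (inner ℝ (e i) x) ^ 2) = fun i => inner ℝ x (e i) * inner ℝ (e i) x := by
    funext i
    rw [real_inner_comm]; ring
  rw [h]
  exact this

lemma norm_le_of_coord (x y : H) (c : ℝ) (hc : 0 ≤ c)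
    (h : ∀ i, |inner ℝ (e i) y| ≤ c * |inner ℝ (e i) x|) : ‖y‖ ≤ c * ‖x‖ := by
  refine le_of_sq_le_sq ?_ (by positivity)
  rw [mul_pow]
  refine hasSum_le (fun i => ?_) (hasSum_sq e y) ((hasSum_sq e x).mul_left (c ^ 2))
  rw [← mul_pow, ← sq_abs (inner ℝ (e i) y), ← sq_abs (c * _), abs_mul, abs_of_nonneg hc]
  have := h i
  gcongr

lemma diag_symm (D : H →L[ℝ] H) (d : ℕ → ℝ) (hD : ∀ i, D (e i) = d i • e i) :
    D.toLinearMap.IsSymmetric := by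
  intro x y
  simp only [ContinuousLinearMap.coe_coe]
  rw [← e.tsum_inner_mul_inner, ← e.tsum_inner_mul_inner]
  refine tsum_congr fun i => ?_
  rw [real_inner_comm, diag_inner e D d hD, diag_inner e D d hD, real_inner_comm x]
  ring

lemma diag_inj (D : H →L[ℝ] H) (d : ℕ → ℝ) (hD : ∀ i, D (e i) = d i • e i)
    (hd : ∀ i, d i ≠ 0) : Function.Injective D := by
  rw [injective_iff_map_eq_zero]
  intro x hx
  have h0 : ∀ i, inner ℝ (e i) x = 0 := by
    intro i
    have := diag_inner e D d hD i x
    rw [hx, inner_zero_right] at this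
    simpa [hd i] using this.symm
  have := norm_le_of_coord e 0 x 0 le_rfl (by simp [h0])
  simpa using this

lemma diag_dense (D : H →L[ℝ] H) (d : ℕ → ℝ) (hD : ∀ i, D (e i) = d i • e i)
    (hd : ∀ i, d i ≠ 0) : DenseRange D := by
  have h1 : Dense ((Submodule.span ℝ (Set.range e) : Submodule ℝ H) : Set H) := by
    rw [Submodule.dense_iff_topologicalClosure_eq_top]; exact e.dense_span
  refine h1.mono ?_
  have : Submodule.span ℝ (Set.range e) ≤ LinearMap.range D.toLinearMap := by
    rw [Submodule.span_le]
    rintro _ ⟨i, rfl⟩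
    refine ⟨(d i)⁻¹ • e i, ?_⟩
    simp [hD, smul_smul, hd i]
  exact this

/-- Span of the first `n` basis vectors. -/
def spanN (n : ℕ) : Submodule ℝ H := Submodule.span ℝ (Set.range fun i : Fin n => e i)

instance (n : ℕ) : FiniteDimensional ℝ (spanN e n) :=
  FiniteDimensional.span_of_finite ℝ (Set.finite_range _)

lemma finrank_spanN (n : ℕ) : Module.finrank ℝ (spanN e n) = n := by
  have h : LinearIndependent ℝ fun i : Fin n => e i :=
    e.orthonormal.linearIndependent.comp _ Fin.val_injective
  rw [spanN, finrank_span_eq_card h]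
  simp

lemma spanN_inv (D : H →L[ℝ] H) (d : ℕ → ℝ) (hD : ∀ i, D (e i) = d i • e i) (n : ℕ) :
    ∀ x ∈ spanN e n, D x ∈ spanN e n := by
  have : spanN e n ≤ (spanN e n).comap D.toLinearMap := by
    rw [spanN, Submodule.span_le]
    rintro _ ⟨i, rfl⟩
    simp only [Submodule.comap_coe, Set.mem_preimage, ContinuousLinearMap.coe_coe, hD]
    exact Submodule.smul_mem _ _ (Submodule.subset_span ⟨i, rfl⟩)
  exact this

lemma diag_tail (D : H →L[ℝ] H) (d : ℕ → ℝ) (hD : ∀ i, D (e i) = d i • e i) (n : ℕ)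
    (ε : ℝ) (hε : 0 ≤ ε) (hd : ∀ i, n ≤ i → |d i| ≤ ε) (x : H) :
    ‖D x - (spanN e n).starProjection (D x)‖ ≤ ε * ‖x‖ := by
  refine norm_le_of_coord e _ _ ε hε fun i => ?_
  rw [inner_sub_right, ← Submodule.inner_starProjection_left_eq_right]
  rcases lt_or_ge i n with h | h
  · have : e i ∈ spanN e n := Submodule.subset_span ⟨⟨i, h⟩, rfl⟩
    rw [Submodule.starProjection_eq_self_iff.2 this, sub_self, abs_zero]
    positivity
  · have : e i ∈ (spanN e n)ᗮ := by
      rw [Submodule.mem_orthogonal]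
      intro u hu
      have hle : spanN e n ≤ LinearMap.ker (innerₛₗ ℝ (e i)) := by
        rw [spanN, Submodule.span_le]
        rintro _ ⟨j, rfl⟩
        have hij : i ≠ (j : ℕ) := by have := j.2; omega
        simpa using e.orthonormal.2 hij
      rw [real_inner_comm]
      simpa using hle hu
    rw [(Submodule.starProjection_apply_eq_zero_iff _).2 this, inner_zero_left, sub_zero,
      diag_inner e D d hD, abs_mul]
    have := hd i h
    gcongr

lemma key_infinite (A D : H →L[ℝ] H) (d : ℕ → ℝ) (hD : ∀ i, D (e i) = d i • e i)
    (hd : ∀ i, d i ≠ 0) (hd0 : Filter.Tendsto d Filter.atTop (nhds 0)) (k : ℕ) :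
    ∏ j ∈ Finset.range k, singVal (D ∘L A ∘L D) (j + 1) ^ 2 ≤
      (∏ j ∈ Finset.range k, singVal A (j + 1)) *
      ∏ j ∈ Finset.range k, singVal (D ∘L (D ∘L A ∘L D) ∘L D) (j + 1) := by
  set M := D ∘L A ∘L D with hM
  set R := (∏ j ∈ Finset.range k, singVal A (j + 1)) *
      ∏ j ∈ Finset.range k, singVal (D ∘L M ∘L D) (j + 1) with hR
  have hDs := diag_symm e D d hD
  have hDi := diag_inj e D d hD hd
  have main : ∀ δ > 0, ∏ j ∈ Finset.range k, (max (singVal M (j + 1) - δ) 0) ^ 2 ≤ R := by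
    intro δ hδ
    set ε : ℝ := δ / (2 * (‖A‖ * ‖D‖ + 1)) with hε
    have hε0 : 0 < ε := by positivity
    have hεle : 2 * (ε * (‖A‖ * ‖D‖)) ≤ δ := by
      have : ε * (2 * (‖A‖ * ‖D‖ + 1)) = δ := div_mul_cancel₀ _ (by positivity)
      nlinarith
    obtain ⟨N, hN⟩ := Filter.eventually_atTop.1 ((Metric.tendsto_nhds.1 hd0) ε hε0)
    set n := max N k with hn
    set W := spanN e n with hW
    have hWinv := spanN_inv e D d hD n
    have tail : ∀ x, ‖D x - W.starProjection (D x)‖ ≤ ε * ‖x‖ :=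
      diag_tail e D d hD n ε hε0.le (fun i hi => by
        have := hN i ((le_max_left _ _).trans hi)
        rw [Real.dist_eq, sub_zero] at this
        exact this.le)
    have happ : ∀ x, ‖M x - W.starProjection (M (W.starProjection x))‖ ≤ δ * ‖x‖ := by
      intro x
      have e1 : M x - W.starProjection (M (W.starProjection x)) =
          (D (A (D x)) - W.starProjection (D (A (D x)))) +
            W.starProjection (D (A (D x - W.starProjection (D x)))) := by
        simp only [hM, ContinuousLinearMap.comp_apply, map_sub]
        rw [proj_comm W D hDs hWinv x]
        abel
      have h1 : ‖D (A (D x)) - W.starProjection (D (A (D x)))‖ ≤ ε * (‖A‖ * (‖D‖ * ‖x‖)) := by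
        refine (tail _).trans ?_
        gcongr
        exact (A.le_opNorm _).trans (by gcongr; exact D.le_opNorm _)
      have h2 : ‖W.starProjection (D (A (D x - W.starProjection (D x))))‖ ≤
          ‖D‖ * (‖A‖ * (ε * ‖x‖)) := by
        refine (Submodule.norm_starProjection_apply_le _ _).trans ?_
        refine (D.le_opNorm _).trans ?_
        gcongr
        refine (A.le_opNorm _).trans ?_
        gcongr
        exact tail x
      rw [e1]
      refine (norm_add_le _ _).trans ?_
      have h3 := mul_le_mul_of_nonneg_right hεle (norm_nonneg x)
      nlinarith
    have hfin := key_finite (comprTo W A) (comprTo W D) (comprTo_symm W D hDs hWinv)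
      (comprTo_inj W D hDi hWinv) k (by rw [finrank_spanN]; exact le_max_right _ _)
    rw [← comprTo_comp W A D hDs hWinv, ← comprTo_comp W _ D hDs hWinv] at hfin
    refine le_trans ?_ (hfin.trans ?_)
    · refine Finset.prod_le_prod (fun _ _ => sq_nonneg _) fun j _ => ?_
      have := le_singVal_comprTo W M δ happ hδ.le j
      have h4 : max (singVal M (j + 1) - δ) 0 ≤ singVal (comprTo W M) (j + 1) :=
        max_le this (singVal_nonneg _ _)
      have h5 : (0 : ℝ) ≤ max (singVal M (j + 1) - δ) 0 := le_max_right _ _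
      gcongr
    · refine mul_le_mul ?_ ?_ (Finset.prod_nonneg fun _ _ => singVal_nonneg _ _)
        (Finset.prod_nonneg fun _ _ => singVal_nonneg _ _)
      · exact Finset.prod_le_prod (fun _ _ => singVal_nonneg _ _)
          fun j _ => singVal_comprTo_le W A j
      · exact Finset.prod_le_prod (fun _ _ => singVal_nonneg _ _)
          fun j _ => singVal_comprTo_le W _ j
  have hcont : Continuous fun δ : ℝ =>
      ∏ j ∈ Finset.range k, (max (singVal M (j + 1) - δ) 0) ^ 2 := by
    refine continuous_finsetProd _ fun j _ => ?_
    fun_prop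
  have hlim := (hcont.tendsto 0).mono_left (nhdsWithin_le_nhds (s := Set.Ioi 0))
  have := le_of_tendsto hlim (Filter.eventually_of_mem self_mem_nhdsWithin main)
  simpa [max_eq_left (singVal_nonneg _ _)] using this

lemma singVal_pos_iff (B : H →L[ℝ] H) (j : ℕ) :
    0 < singVal B (j + 1) ↔ ∃ y : Fin (j + 1) → H, LinearIndependent ℝ fun i => B (y i) := by
  constructor
  · intro h
    obtain ⟨V, hV, hVc⟩ := exists_of_lt_singVal B.toLinearMap (j := j + 1)
      (singVal B (j + 1) / 2) (by positivity) (by simpa using h)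
    have : FiniteDimensional ℝ V := Module.finite_of_finrank_pos (by omega)
    let b := (Module.finBasisOfFinrankEq ℝ V hV)
    refine ⟨fun i => b i, ?_⟩
    refine b.linearIndependent.map' (B.toLinearMap.domRestrict V) ?_
    rw [LinearMap.ker_eq_bot']
    intro x hx
    have h1 := hVc x x.2
    have h2 : B.toLinearMap (x : H) = 0 := hx
    rw [h2, norm_zero] at h1
    have h3 : ‖(x : H)‖ ≤ 0 := by
      by_contra hc
      push Not at hc
      have : 0 < singVal B (j + 1) / 2 * ‖(x : H)‖ := by positivity
      linarith
    simpa using h3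
  · rintro ⟨y, hy⟩
    have hy' : LinearIndependent ℝ y := LinearIndependent.of_comp B.toLinearMap hy
    let V := Submodule.span ℝ (Set.range y)
    have hV : Module.finrank ℝ V = j + 1 := by rw [finrank_span_eq_card hy']; simp
    have : FiniteDimensional ℝ V := Module.finite_of_finrank_pos (by omega)
    let f := B.toLinearMap.domRestrict V
    have hf : LinearMap.ker f = ⊥ := by
      have hr : LinearMap.range f = Submodule.span ℝ (Set.range fun i => B (y i)) := by
        rw [LinearMap.range_domRestrict, Submodule.map_span, ← Set.range_comp]
        rfl
      have h1 := f.finrank_range_add_finrank_ker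
      rw [hr, finrank_span_eq_card hy, hV, Fintype.card_fin] at h1
      exact Submodule.finrank_eq_zero.1 (by omega)
    obtain ⟨K, hK, hKf⟩ := f.exists_antilipschitzWith hf
    have hK' : (0 : ℝ) < K := by exact_mod_cast hK
    have : (K : ℝ)⁻¹ ≤ singVal B (j + 1) := by
      refine le_singVal B.toLinearMap ‖B‖ B.le_opNorm V hV _ ?_
      intro x hx
      have := hKf.le_mul_dist ⟨x, hx⟩ 0
      simp only [dist_zero_right, map_zero] at this
      rw [inv_mul_le_iff₀ hK']
      exact this
    exact lt_of_lt_of_le (by positivity) this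

lemma singVal_pos_of_le (B : H →L[ℝ] H) {j k : ℕ} (hjk : j ≤ k) (h : 0 < singVal B (k + 1)) :
    0 < singVal B (j + 1) := by
  rw [singVal_pos_iff] at h ⊢
  obtain ⟨y, hy⟩ := h
  exact ⟨fun i => y (Fin.castLE (by omega) i), hy.comp _ (Fin.castLE_injective (by omega))⟩

lemma singVal_pos_diag (A D : H →L[ℝ] H) (d : ℕ → ℝ) (hD : ∀ i, D (e i) = d i • e i)
    (hd : ∀ i, d i ≠ 0) (j : ℕ) (h : 0 < singVal A (j + 1)) :
    0 < singVal (D ∘L A ∘L D) (j + 1) := by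
  rw [singVal_pos_iff] at h ⊢
  obtain ⟨y, hy⟩ := h
  have hopen : IsOpen {f : Fin (j + 1) → H | LinearIndependent ℝ fun i => A (f i)} := by
    have hc : Continuous fun f : Fin (j + 1) → H => fun i => A (f i) := by fun_prop
    exact isOpen_setOfPred_linearIndependent.preimage hc
  have hdense : DenseRange (Pi.map (fun _ : Fin (j + 1) => (D : H → H))) :=
    DenseRange.piMap fun _ => diag_dense e D d hD hd
  obtain ⟨z, hz⟩ := hdense.exists_mem_open hopen ⟨y, hy⟩
  refine ⟨z, ?_⟩
  exact LinearIndependent.map' hz D.toLinearMap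
    (LinearMap.ker_eq_bot.2 (diag_inj e D d hD hd))

lemma norm_rankOne (i : ℕ) : ‖(innerSL ℝ (e i)).smulRight (e i)‖ ≤ 1 := by
  refine ContinuousLinearMap.opNorm_le_bound _ zero_le_one fun x => ?_
  rw [ContinuousLinearMap.smulRight_apply, norm_smul, e.orthonormal.1 i, mul_one, one_mul,
    innerSL_apply_apply]
  have := norm_inner_le_norm (𝕜 := ℝ) (e i) x
  rwa [e.orthonormal.1 i, one_mul] at this

lemma exists_diag [CompleteSpace H] (d : ℕ → ℝ) (hd : Summable fun i => |d i|) :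
    ∃ D : H →L[ℝ] H, ∀ i, D (e i) = d i • e i := by
  obtain ⟨f, hf1, hf2⟩ : ∃ f : ℕ → H →L[ℝ] H, (∀ i, ‖f i‖ ≤ |d i|) ∧
      ∀ i x, f i x = d i • (inner ℝ (e i) x • e i) := by
    refine ⟨fun i => d i • (innerSL ℝ (e i)).smulRight (e i), fun i => ?_, fun i x => rfl⟩
    rw [norm_smul, Real.norm_eq_abs]
    exact mul_le_of_le_one_right (abs_nonneg _) (norm_rankOne e i)
  have hf : Summable f := Summable.of_norm_bounded hd hf1
  refine ⟨∑' i, f i, fun j => ?_⟩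
  have h1 : HasSum (fun i => f i (e j)) ((∑' i, f i) (e j)) :=
    (ContinuousLinearMap.apply ℝ H (e j)).hasSum hf.hasSum
  have h2 : HasSum (fun i => f i (e j)) (f j (e j)) := by
    refine hasSum_single j fun i hij => ?_
    rw [hf2, e.orthonormal.2 hij, zero_smul, smul_zero]
  rw [h1.unique h2, hf2, real_inner_self_eq_norm_sq, e.orthonormal.1 j, one_pow, one_smul]

/-- multiplying by diagonal contractions decreases singular values -/
lemma singVal_diag_le (B D : H →L[ℝ] H) (d : ℕ → ℝ) (hD : ∀ i, D (e i) = d i • e i)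
    (hd : ∀ i, d i ≠ 0) (hd1 : ∀ i, |d i| ≤ 1) (j : ℕ) :
    singVal (D ∘L B ∘L D) (j + 1) ≤ singVal B (j + 1) := by
  have hc : ∀ x, ‖D x‖ ≤ ‖x‖ := fun x => by
    have := norm_le_of_coord e x (D x) 1 zero_le_one (fun i => by
      rw [diag_inner e D d hD, abs_mul]
      have := hd1 i
      gcongr)
    simpa using this
  exact singVal_le_singVal B.toLinearMap ‖B‖ B.le_opNorm (D ∘L B ∘L D).toLinearMap D.toLinearMap
    (diag_inj e D d hD hd) hc (fun x => hc _) j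

lemma diag_ext (D D' : H →L[ℝ] H) (h : ∀ i, D (e i) = D' (e i)) : D = D' := by
  refine ContinuousLinearMap.ext_on (s := Set.range e) ?_ ?_
  · rw [Submodule.dense_iff_topologicalClosure_eq_top]; exact e.dense_span
  · rintro _ ⟨j, rfl⟩
    exact h j

end diag

theorem stmt15 {H : Type*} [NormedAddCommGroup H] [InnerProductSpace ℝ H] [CompleteSpace H]
    (e : HilbertBasis ℕ ℝ H)
    (A : H →L[ℝ] H) (hHS : Summable fun i => ‖A (e i)‖ ^ 2)
    (D3 D2 : H →L[ℝ] H)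
    (hD3 : ∀ i : ℕ, D3 (e i) = ((3 : ℝ) ^ (i + 1))⁻¹ • e i)
    (hD2 : ∀ i : ℕ, D2 (e i) = ((2 : ℝ) ^ (i + 1))⁻¹ • e i)
    (k : ℕ) (hA : 0 < singVal ⇑A k) :
    Xi k ⇑(D3 ∘L A ∘L D3) - Xi k ⇑A ≥
      (Real.log 3 / Real.log 2) ^ 2 * (Xi k ⇑(D2 ∘L A ∘L D2) - Xi k ⇑A) := by
  have hd2 : ∀ i : ℕ, ((2 : ℝ) ^ (i + 1))⁻¹ ≠ 0 := fun i => by positivity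
  have hd2' : ∀ i : ℕ, |((2 : ℝ) ^ (i + 1))⁻¹| ≤ 1 := fun i => by
    rw [abs_of_pos (by positivity)]
    exact inv_le_one_of_one_le₀ (one_le_pow₀ (by norm_num))
  have hlim : Filter.Tendsto (fun i : ℕ => ((2 : ℝ) ^ (i + 1))⁻¹) Filter.atTop (nhds 0) := by
    have := (tendsto_pow_atTop_nhds_zero_of_lt_one (r := (2 : ℝ)⁻¹) (by norm_num)
      (by norm_num)).comp (Filter.tendsto_add_atTop_nat 1)
    simpa [Function.comp_def] using this
  set M := D2 ∘L A ∘L D2 with hM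
  -- the diagonal contraction with entries (3/4)^(i+1)
  obtain ⟨C, hC⟩ := exists_diag e (fun i => (3 / 4 : ℝ) ^ (i + 1)) (by
    have := (summable_nat_add_iff 1).2
      (summable_geometric_of_lt_one (r := (3 / 4 : ℝ)) (by norm_num) (by norm_num))
    refine this.congr fun i => ?_
    rw [abs_of_pos (by positivity)])
  have h1 : D2 ∘L D2 = C ∘L D3 := by
    refine diag_ext e _ _ fun i => ?_
    simp only [ContinuousLinearMap.comp_apply, hD2, hD3, map_smul, hC, smul_smul]
    congr 1
    rw [div_pow, show (4 : ℝ) = 2 * 2 by norm_num, mul_pow]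
    field_simp
  have h2 : D2 ∘L D2 = D3 ∘L C := by
    rw [h1]
    refine diag_ext e _ _ fun i => ?_
    simp only [ContinuousLinearMap.comp_apply, hD3, map_smul, hC, smul_smul]
    rw [mul_comm]
  have h4 : D2 ∘L M ∘L D2 = C ∘L (D3 ∘L A ∘L D3) ∘L C := by
    ext x
    have e1 : ∀ x, D2 (D2 x) = C (D3 x) := fun x => congrArg (fun f => f x) h1
    have e2 : ∀ x, D2 (D2 x) = D3 (C x) := fun x => congrArg (fun f => f x) h2
    simp only [hM, ContinuousLinearMap.comp_apply]
    rw [e1, e2]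
  have hpos : ∀ j ∈ Finset.range k, 0 < singVal A (j + 1) := by
    intro j hj
    obtain ⟨k', rfl⟩ : ∃ k', k = k' + 1 := ⟨k - 1, by have := Finset.mem_range.1 hj; omega⟩
    exact singVal_pos_of_le A (by have := Finset.mem_range.1 hj; omega) hA
  have hMpos : ∀ j ∈ Finset.range k, 0 < singVal M (j + 1) := fun j hj =>
    singVal_pos_diag e A D2 _ hD2 hd2 j (hpos j hj)
  have hBpos : ∀ j ∈ Finset.range k, 0 < singVal (D2 ∘L M ∘L D2) (j + 1) := fun j hj =>
    singVal_pos_diag e M D2 _ hD2 hd2 j (hMpos j hj)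
  have hBle : ∀ j, singVal (D2 ∘L M ∘L D2) (j + 1) ≤ singVal (D3 ∘L A ∘L D3) (j + 1) := by
    intro j
    rw [h4]
    refine singVal_diag_le e _ C _ hC (fun i => by positivity) (fun i => ?_) j
    rw [abs_of_pos (by positivity)]
    exact pow_le_one₀ (by norm_num) (by norm_num)
  have hXiMA : Xi k M ≤ Xi k A := Finset.sum_le_sum fun j hj =>
    Real.log_le_log (hMpos j hj) (singVal_diag_le e A D2 _ hD2 hd2 hd2' j)
  have hXiB3 : Xi k (D2 ∘L M ∘L D2) ≤ Xi k (D3 ∘L A ∘L D3) := Finset.sum_le_sum fun j hj =>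
    Real.log_le_log (hBpos j hj) (hBle j)
  have hkey : 2 * Xi k M ≤ Xi k A + Xi k (D2 ∘L M ∘L D2) := by
    have := key_infinite e A D2 _ hD2 hd2 hlim k
    rw [← hM] at this
    have h5 := Real.log_le_log (Finset.prod_pos fun j hj => pow_pos (hMpos j hj) 2) this
    rw [Real.log_mul (Finset.prod_pos hpos).ne' (Finset.prod_pos hBpos).ne',
      Real.log_prod (fun j hj => (hpos j hj).ne'), Real.log_prod (fun j hj => (hBpos j hj).ne'),
      Real.log_prod (fun j hj => (pow_pos (hMpos j hj) 2).ne')] at h5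
    simp only [Real.log_pow, Nat.cast_ofNat, ← Finset.mul_sum] at h5
    exact h5
  have hr : (2 : ℝ) ≤ (Real.log 3 / Real.log 2) ^ 2 := by
    have hl2 : 0 < Real.log 2 := Real.log_pos (by norm_num)
    have : (3 / 2 : ℝ) ≤ Real.log 3 / Real.log 2 := by
      rw [le_div_iff₀ hl2]
      have h6 : Real.log (2 ^ 3) ≤ Real.log (3 ^ 2) :=
        Real.log_le_log (by norm_num) (by norm_num)
      rw [Real.log_pow, Real.log_pow] at h6
      push_cast at h6
      linarith
    nlinarith
  nlinarith
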